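/- Let X be a compact metric space, A ⊆ X a closed subset which is a UV¹ subset of X, and suppose every point x ∈ X \ A has a neighborhood basis of path-connected, simply connected open sets. Let B be a metric space and let p : X → B be a continuous closed surjection which maps A to a single point b₀ ∈ B and is injective on X \ A, with p⁻¹(b₀) = A (so p is the quotient map collapsing A to a point). Then p is a UV¹ map, i.e. p is UV¹(δ) for every δ > 0. -/

import Mathlib

/-- `A` is a `UV¹` subset of `X`: for every open `U ⊇ A` there is an open `V` with
`A ⊆ V ⊆ U` such that any two points of `V` are joined by a path in `U`, and every
loop in `V` is path-homotopic in `U` to a constant loop. -/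
def IsUV1Subset {X : Type*} [TopologicalSpace X] (A : Set X) : Prop :=
  ∀ U : Set X, IsOpen U → A ⊆ U →
    ∃ (V : Set X) (hVU : V ⊆ U), IsOpen V ∧ A ⊆ V ∧
      (∀ x ∈ V, ∀ y ∈ V, JoinedIn U x y) ∧
      (∀ (x : X) (hx : x ∈ V)
        (γ : Path (⟨x, hVU hx⟩ : U) (⟨x, hVU hx⟩ : U)),
        (∀ t, (γ t : X) ∈ V) →
        Path.Homotopic γ (Path.refl (⟨x, hVU hx⟩ : U)))

/-- `p : X → B` is a `UV¹(δ)` map. -/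
def IsUV1MapAt {X B : Type*} [TopologicalSpace X] [MetricSpace B]
    (p : X → B) (δ : ℝ) : Prop :=
  ∀ (n : ℕ) (K K₀ : Geometry.SimplicialComplex ℝ (EuclideanSpace ℝ (Fin n))),
    K.faces.Finite →
    (∀ s ∈ K.faces, s.card ≤ 3) →
    K₀.faces ⊆ K.faces →
    ∀ (α₀ : K₀.space → X) (α : K.space → B),
      Continuous α₀ → Continuous α →
      (∀ (u : K₀.space) (hu : (u : EuclideanSpace ℝ (Fin n)) ∈ K.space),
        p (α₀ u) = α ⟨u, hu⟩) →
      ∃ αbar : K.space → X, Continuous αbar ∧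
        (∀ (u : K₀.space) (hu : (u : EuclideanSpace ℝ (Fin n)) ∈ K.space),
          αbar ⟨u, hu⟩ = α₀ u) ∧
        ∀ u : K.space, dist (p (αbar u)) (α u) < δ

/-- `p` is a `UV¹` map if it is `UV¹(δ)` for every `δ > 0`. -/
def IsUV1Map {X B : Type*} [TopologicalSpace X] [MetricSpace B]
    (p : X → B) : Prop :=
  ∀ δ : ℝ, 0 < δ → IsUV1MapAt p δ

section

open Set Metric Topology

/-- The relative approximate lifting property of the pair `D ⊆ C` over `α`, along `p`: partial lifts
on `D` that are `ε`-close to `α` extend to lifts on `C` that are `δ`-close to `α`. -/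
def HasApproxLift {E X B : Type*} [TopologicalSpace E] [TopologicalSpace X] [MetricSpace B]
    (p : X → B) (ε δ : ℝ) (C D : Set E) (α : E → B) : Prop :=
  ∀ f : E → X, ContinuousOn f D → (∀ u ∈ D, dist (p (f u)) (α u) < ε) →
    ∃ g : E → X, ContinuousOn g C ∧ EqOn g f D ∧ ∀ u ∈ C, dist (p (g u)) (α u) < δ

/-- Inclusion `V → U` induces trivial maps on path components and on free homotopy classes of
loops. -/
def IsNullInclusion {X : Type*} [TopologicalSpace X] (V U : Set X) : Prop :=
  (∀ x ∈ V, ∀ y ∈ V, JoinedIn U x y) ∧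
    ∀ f : ℂ → X, ContinuousOn f (sphere 0 1) → MapsTo f (sphere 0 1) V →
      ∃ g : ℂ → X, ContinuousOn g (closedBall 0 1) ∧ MapsTo g (closedBall 0 1) U ∧
        EqOn g f (sphere 0 1)

/-- A continuous function on a compact set descends along a continuous surjection whose fibres it
respects. -/
theorem exists_continuousOn_descend {E E' X : Type*} [TopologicalSpace E] [TopologicalSpace E']
    [T2Space E] [TopologicalSpace X] [Nonempty X] {C' : Set E'} (hC' : IsCompact C') {q : E' → E}
    (hq : ContinuousOn q C') {G : E' → X} (hG : ContinuousOn G C')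
    (hfib : ∀ z ∈ C', ∀ w ∈ C', q z = q w → G z = G w) :
    ∃ g : E → X, ContinuousOn g (q '' C') ∧ ∀ z ∈ C', g (q z) = G z := by
  classical
  let g : E → X := fun x => if h : ∃ z ∈ C', q z = x then G h.choose else Classical.arbitrary X
  have hg : ∀ z ∈ C', g (q z) = G z := by
    intro z hz
    have h : ∃ w ∈ C', q w = q z := ⟨z, hz, rfl⟩
    simp only [g, dif_pos h]
    exact hfib _ h.choose_spec.1 _ hz h.choose_spec.2
  refine ⟨g, ?_, hg⟩
  have : CompactSpace C' := isCompact_iff_compactSpace.1 hC'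
  let q' : C' → q '' C' := fun z => ⟨q z, mem_image_of_mem q z.2⟩
  have hq' : Continuous q' := (continuousOn_iff_continuous_domRestrict.1 hq).subtype_mk _
  have hsurj : Function.Surjective q' := by
    rintro ⟨_, z, hz, rfl⟩
    exact ⟨⟨z, hz⟩, rfl⟩
  have hquot : IsQuotientMap q' := hq'.isClosedMap.isQuotientMap hq' hsurj
  rw [continuousOn_iff_continuous_domRestrict, hquot.continuous_iff]
  convert continuousOn_iff_continuous_domRestrict.1 hG using 1
  ext z
  exact hg z z.2

section Lift

variable {E E' X B : Type*} [TopologicalSpace E] [TopologicalSpace E'] [TopologicalSpace X]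
  [MetricSpace B] {p : X → B} {ε δ η : ℝ}

namespace HasApproxLift

theorem refl (h : ε ≤ δ) (C : Set E) (α : E → B) : HasApproxLift p ε δ C C α :=
  fun f hf hd => ⟨f, hf, fun _ _ => rfl, fun u hu => (hd u hu).trans_le h⟩

theorem trans {S₀ S₁ S₂ : Set E} {α : E → B} (h₁ : HasApproxLift p ε δ S₁ S₀ α)
    (h₂ : HasApproxLift p δ η S₂ S₁ α) (hS : S₀ ⊆ S₁) : HasApproxLift p ε η S₂ S₀ α := by
  intro f hf hd
  obtain ⟨g, hg, hgf, hgd⟩ := h₁ f hf hd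
  obtain ⟨k, hk, hkg, hkd⟩ := h₂ g hg hgd
  exact ⟨k, hk, (hkg.mono hS).trans hgf, hkd⟩

theorem mono_set {C C' D : Set E} {α : E → B} (h : HasApproxLift p ε δ C D α) (hC : C' ⊆ C) :
    HasApproxLift p ε δ C' D α := by
  intro f hf hd
  obtain ⟨g, hg, hgf, hgd⟩ := h f hf hd
  exact ⟨g, hg.mono hC, hgf, fun u hu => hgd u (hC hu)⟩

/-- Transfer along a relative homeomorphism `(C', D') → (C, D)`. -/
theorem image [T2Space E] [Nonempty X] {C' D' : Set E'} {q : E' → E} {D : Set E} {α : E → B}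
    (hC' : IsCompact C') (hq : ContinuousOn q C') (hDC : D' ⊆ C') (hD : q '' D' = D)
    (hfib : ∀ z ∈ C', ∀ w ∈ C', q z = q w → z = w ∨ z ∈ D' ∧ w ∈ D')
    (h : HasApproxLift p ε δ C' D' (α ∘ q)) : HasApproxLift p ε δ (q '' C') D α := by
  subst hD
  intro f hf hd
  obtain ⟨G, hG, hGf, hGd⟩ := h (f ∘ q) (hf.comp (hq.mono hDC) (mapsTo_image q D'))
    fun u hu => hd _ (mem_image_of_mem q hu)
  obtain ⟨g, hg, hgG⟩ := exists_continuousOn_descend hC' hq hG (by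
    intro z hz w hw hzw
    rcases hfib z hz w hw hzw with rfl | ⟨hz', hw'⟩
    · rfl
    · rw [hGf hz', hGf hw', Function.comp_apply, Function.comp_apply, hzw])
  refine ⟨g, hg, ?_, ?_⟩
  · rintro _ ⟨z, hz, rfl⟩
    rw [hgG z (hDC hz), hGf hz, Function.comp_apply]
  · rintro _ ⟨z, hz, rfl⟩
    rw [hgG z hz]
    exact hGd z hz

/-- Lifts over finitely many closed cells overlapping only in `S` glue together. -/
theorem union_iUnion {ι : Type*} [Finite ι] {S : Set E} (hS : IsClosed S) {C : ι → Set E}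
    (hC : ∀ i, IsClosed (C i)) (hdisj : ∀ i j, i ≠ j → C i ∩ C j ⊆ S) {α : E → B} (hε : ε ≤ δ)
    (h : ∀ i, HasApproxLift p ε δ (C i) (C i ∩ S) α) :
    HasApproxLift p ε δ (S ∪ ⋃ i, C i) S α := by
  classical
  intro f hf hd
  choose g hg hgf hgd using fun i =>
    h i f (hf.mono inter_subset_right) fun u hu => hd u hu.2
  let k : E → X := fun u => if u ∈ S then f u else if h : ∃ i, u ∈ C i then g h.choose u else f u
  have hkS : EqOn k f S := fun u hu => if_pos hu
  have hkC : ∀ i, EqOn k (g i) (C i) := by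
    intro i u hu
    by_cases huS : u ∈ S
    · rw [hkS huS, hgf i ⟨hu, huS⟩]
    · have hex : ∃ i, u ∈ C i := ⟨i, hu⟩
      have : hex.choose = i := by
        by_contra hne
        exact huS (hdisj _ _ hne ⟨hex.choose_spec, hu⟩)
      simp only [k, if_neg huS, dif_pos hex]
      rw [this]
  have hkcS : ContinuousOn k S := hf.congr hkS
  have hkcC : ContinuousOn k (⋃ i, C i) :=
    (locallyFinite_of_finite C).continuousOn_iUnion hC fun i => (hg i).congr (hkC i)
  refine ⟨k, hkcS.union_of_isClosed hkcC hS (isClosed_iUnion_of_finite hC), hkS, ?_⟩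
  rintro u (hu | hu)
  · rw [hkS hu]
    exact (hd u hu).trans_le hε
  · obtain ⟨i, hi⟩ := mem_iUnion.1 hu
    rw [hkC i hi]
    exact hgd i u hi

theorem singleton (hp : Function.Surjective p) (hδ : 0 < δ) (x : E) (α : E → B) :
    HasApproxLift p ε δ {x} ∅ α := by
  intro f _ _
  obtain ⟨y, hy⟩ := hp (α x)
  refine ⟨fun _ => y, continuousOn_const, fun _ h => h.elim, ?_⟩
  rintro u rfl
  simpa [hy] using hδ

end HasApproxLift

end Lift

section NullInclusion

variable {X : Type*} [TopologicalSpace X]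

theorem IsNullInclusion.mono {V V' U U' : Set X} (h : IsNullInclusion V U) (hV : V' ⊆ V)
    (hU : U ⊆ U') : IsNullInclusion V' U' := by
  refine ⟨fun x hx y hy => (h.1 x (hV hx) y (hV hy)).mono hU, fun f hf hfV => ?_⟩
  obtain ⟨g, hg, hgU, hgf⟩ := h.2 f hf (hfV.mono_right hV)
  exact ⟨g, hg, hgU.mono_right hU, hgf⟩

theorem Complex.exists_unitInterval_polar {z : ℂ} (hz : z ∈ closedBall (0 : ℂ) 1) :
    ∃ s t : unitInterval, (1 - (s : ℝ) : ℂ) * Complex.exp (2 * Real.pi * (t : ℝ) * Complex.I) = z ∧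
      1 - (s : ℝ) = ‖z‖ := by
  rw [mem_closedBall_zero_iff] at hz
  refine ⟨⟨1 - ‖z‖, by linarith, by linarith [norm_nonneg z]⟩,
    ⟨Int.fract (Complex.arg z / (2 * Real.pi)), Int.fract_nonneg _, (Int.fract_lt_one _).le⟩,
    ?_, by simp⟩
  have hpi : (Real.pi : ℂ) ≠ 0 := by exact_mod_cast Real.pi_ne_zero
  have : (2 * Real.pi * (Int.fract (Complex.arg z / (2 * Real.pi)) : ℝ) * Complex.I : ℂ) =
      Complex.arg z * Complex.I -
        (⌊Complex.arg z / (2 * Real.pi)⌋ : ℂ) * (2 * Real.pi * Complex.I) := by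
    rw [Int.fract]
    push_cast
    field_simp
  simp only [this, Complex.exp_periodic.sub_int_mul_eq]
  push_cast
  rw [sub_sub_cancel, Complex.norm_mul_exp_arg_mul_I]

theorem Complex.polar_unitInterval_eq {s t s' t' : unitInterval}
    (h : (1 - (s : ℝ) : ℂ) * Complex.exp (2 * Real.pi * (t : ℝ) * Complex.I) =
      (1 - (s' : ℝ) : ℂ) * Complex.exp (2 * Real.pi * (t' : ℝ) * Complex.I)) :
    s = s' ∧ (s = 1 ∨ t = t' ∨ ((t = 0 ∨ t = 1) ∧ (t' = 0 ∨ t' = 1))) := by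
  have hnorm : ∀ s t : unitInterval,
      ‖(1 - (s : ℝ) : ℂ) * Complex.exp (2 * Real.pi * (t : ℝ) * Complex.I)‖ = 1 - (s : ℝ) := by
    intro s t
    have h1 : (1 - (s : ℝ) : ℂ) = ((1 - (s : ℝ) : ℝ) : ℂ) := by push_cast; rfl
    have h2 : (2 * Real.pi * (t : ℝ) * Complex.I : ℂ) =
      ((2 * Real.pi * (t : ℝ) : ℝ) : ℂ) * Complex.I := by push_cast; rfl
    rw [norm_mul, h2, Complex.norm_exp_ofReal_mul_I, mul_one, h1, Complex.norm_real,
      Real.norm_of_nonneg (sub_nonneg.2 s.2.2)]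
  have hs : (s : ℝ) = s' := by
    have := congrArg norm h
    rw [hnorm, hnorm] at this
    linarith
  have hs' : s = s' := Subtype.ext hs
  refine ⟨hs', ?_⟩
  subst hs'
  by_cases h1 : s = 1
  · exact Or.inl h1
  · right
    have hne : (1 - (s : ℝ) : ℂ) ≠ 0 := by
      intro h0
      apply h1
      ext
      have : (1 : ℂ) = ((s : ℝ) : ℂ) := sub_eq_zero.1 h0
      exact_mod_cast this.symm
    obtain ⟨n, hn⟩ := Complex.exp_eq_exp_iff_exists_int.1 (mul_left_cancel₀ hne h)
    have hpi : (2 * Real.pi * Complex.I : ℂ) ≠ 0 := by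
      simp [Real.pi_ne_zero]
    have hn' : ((t : ℝ) : ℂ) = (t' : ℝ) + n := by
      apply mul_left_cancel₀ hpi
      linear_combination hn
    have hn'' : (t : ℝ) = t' + n := by exact_mod_cast hn'
    have ht := t.2
    have ht' := t'.2
    have hlt : (n : ℝ) < 2 := by linarith [ht.1, ht.2, ht'.1, ht'.2]
    have hgt : (-2 : ℝ) < n := by linarith [ht.1, ht.2, ht'.1, ht'.2]
    have hlt' : n < 2 := by exact_mod_cast hlt
    have hgt' : -2 < n := by exact_mod_cast hgt
    have hcases : n = -1 ∨ n = 0 ∨ n = 1 := by omega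
    rcases hcases with rfl | rfl | rfl
    · push_cast at hn''
      right
      refine ⟨Or.inl (Subtype.ext ?_), Or.inr (Subtype.ext ?_)⟩
      · change (t : ℝ) = 0
        linarith [ht.1, ht.2, ht'.1, ht'.2]
      · change (t' : ℝ) = 1
        linarith [ht.1, ht.2, ht'.1, ht'.2]
    · left
      ext
      simpa using hn''
    · push_cast at hn''
      right
      refine ⟨Or.inr (Subtype.ext ?_), Or.inl (Subtype.ext ?_)⟩
      · change (t : ℝ) = 1
        linarith [ht.1, ht.2, ht'.1, ht'.2]
      · change (t' : ℝ) = 0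
        linarith [ht.1, ht.2, ht'.1, ht'.2]

/-- A null-homotopic loop on the unit circle extends over the closed unit disc. -/
theorem exists_extension_closedBall {U : Set X} {f : ℂ → X}
    {x : U} (γ : Path x x)
    (hγ : ∀ t, (γ t : X) = f (Complex.exp (2 * Real.pi * (t : ℝ) * Complex.I)))
    (hnull : γ.Homotopic (Path.refl x)) :
    ∃ g : ℂ → X, ContinuousOn g (closedBall 0 1) ∧ MapsTo g (closedBall 0 1) U ∧
      EqOn g f (sphere 0 1) := by
  obtain ⟨F⟩ := hnull
  have : Nonempty X := ⟨x⟩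
  let q : unitInterval × unitInterval → ℂ := fun z =>
    (1 - (z.1 : ℝ) : ℂ) * Complex.exp (2 * Real.pi * (z.2 : ℝ) * Complex.I)
  have hq : Continuous q := by fun_prop
  obtain ⟨g, hg, hgG⟩ := exists_continuousOn_descend (C' := univ) isCompact_univ (q := q)
    hq.continuousOn (G := fun z => (F z : X)) (by fun_prop) (by
      rintro ⟨s, t⟩ - ⟨s', t'⟩ - h
      obtain ⟨rfl, h'⟩ := Complex.polar_unitInterval_eq h
      rcases h' with rfl | rfl | ⟨h1, h2⟩
      · simp
      · rfl
      · have hend : ∀ r : unitInterval, r = 0 ∨ r = 1 → F (s, r) = x := by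
          rintro r (rfl | rfl) <;> simp
        change (F (s, t) : X) = F (s, t')
        rw [hend t h1, hend t' h2])
  have hsurj : ∀ z ∈ closedBall (0 : ℂ) 1, ∃ w : unitInterval × unitInterval, q w = z ∧
      1 - (w.1 : ℝ) = ‖z‖ := by
    intro z hz
    obtain ⟨s, t, h, h'⟩ := Complex.exists_unitInterval_polar hz
    exact ⟨(s, t), h, h'⟩
  refine ⟨g, hg.mono ?_, ?_, ?_⟩
  · intro z hz
    obtain ⟨w, hw, -⟩ := hsurj z hz
    exact ⟨w, mem_univ _, hw⟩
  · intro z hz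
    obtain ⟨w, rfl, -⟩ := hsurj z hz
    rw [hgG w (mem_univ _)]
    exact (F w).2
  · intro z hz
    obtain ⟨⟨s, t⟩, hw, hw'⟩ := hsurj z (sphere_subset_closedBall hz)
    rw [mem_sphere_zero_iff_norm.1 hz] at hw'
    have hs : s = 0 := Subtype.ext (by change (s : ℝ) = 0; simpa using hw')
    subst hs
    rw [← hw, hgG _ (mem_univ _)]
    simp [q, hγ]

theorem isNullInclusion_of_path_homotopic {V U : Set X} (hVU : V ⊆ U)
    (hjoin : ∀ x ∈ V, ∀ y ∈ V, JoinedIn U x y)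
    (hloop : ∀ (x : X) (hx : x ∈ V) (γ : Path (⟨x, hVU hx⟩ : U) (⟨x, hVU hx⟩ : U)),
      (∀ t, (γ t : X) ∈ V) → Path.Homotopic γ (Path.refl (⟨x, hVU hx⟩ : U))) :
    IsNullInclusion V U := by
  refine ⟨hjoin, fun f hf hfV => ?_⟩
  have hcirc : ∀ t : unitInterval,
      Complex.exp (2 * Real.pi * (t : ℝ) * Complex.I) ∈ sphere (0 : ℂ) 1 := by
    intro t
    have h2 : (2 * Real.pi * (t : ℝ) * Complex.I : ℂ) =
      ((2 * Real.pi * (t : ℝ) : ℝ) : ℂ) * Complex.I := by push_cast; rfl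
    rw [mem_sphere_zero_iff_norm, h2, Complex.norm_exp_ofReal_mul_I]
  have h1 : (1 : ℂ) ∈ sphere (0 : ℂ) 1 := by simp
  let γ : Path (⟨f 1, hVU (hfV h1)⟩ : U) (⟨f 1, hVU (hfV h1)⟩ : U) :=
    { toFun := fun t => ⟨f (Complex.exp (2 * Real.pi * (t : ℝ) * Complex.I)), hVU (hfV (hcirc t))⟩
      continuous_toFun := by
        refine Continuous.subtype_mk (hf.comp_continuous ?_ hcirc) _
        fun_prop
      source' := by simp
      target' := by simp [Complex.exp_two_pi_mul_I] }
  exact exists_extension_closedBall γ (fun _ => rfl) (hloop _ (hfV h1) γ fun t => hfV (hcirc t))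

end NullInclusion

section FibrewiseNull

variable {X B : Type*} [TopologicalSpace X] [MetricSpace B] {p : X → B}

/-- If all fibres are `UV¹` and the base is compact, then small balls have uniformly null
preimages. -/
theorem exists_uniform_isNullInclusion [CompactSpace B]
    (h : ∀ b : B, ∀ U : Set B, IsOpen U → b ∈ U →
      ∃ V : Set B, IsOpen V ∧ b ∈ V ∧ IsNullInclusion (p ⁻¹' V) (p ⁻¹' U))
    {ε : ℝ} (hε : 0 < ε) :
    ∃ η > 0, ∀ b : B, IsNullInclusion (p ⁻¹' ball b η) (p ⁻¹' ball b ε) := by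
  choose V hVo hVb hV using fun b => h b (ball b (ε / 2)) isOpen_ball (mem_ball_self (half_pos hε))
  obtain ⟨η, hη, hηV⟩ := lebesgue_number_lemma_of_metric (isCompact_univ (X := B))
    (c := fun b => V b ∩ ball b (ε / 2)) (fun b => (hVo b).inter isOpen_ball)
    fun b _ => mem_iUnion.2 ⟨b, hVb b, mem_ball_self (half_pos hε)⟩
  refine ⟨η, hη, fun b => ?_⟩
  obtain ⟨c, hc⟩ := hηV b (mem_univ _)
  refine (hV c).mono (preimage_mono (hc.trans inter_subset_left)) (preimage_mono ?_)
  have hbc : dist b c < ε / 2 := (hc (mem_ball_self hη)).2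
  refine ball_subset_ball' ?_
  rw [dist_comm]
  linarith

/-- Tube lemma for closed maps. -/
theorem IsClosedMap.exists_isOpen_preimage_subset (hp : IsClosedMap p) {W : Set X} (hW : IsOpen W)
    {b : B} (hb : p ⁻¹' {b} ⊆ W) : ∃ V : Set B, IsOpen V ∧ b ∈ V ∧ p ⁻¹' V ⊆ W := by
  refine ⟨(p '' Wᶜ)ᶜ, (hp _ hW.isClosed_compl).isOpen_compl, ?_, ?_⟩
  · rintro ⟨x, hx, hxb⟩
    exact hx (hb hxb)
  · intro x hx
    by_contra hxW
    exact hx (mem_image_of_mem p hxW)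

theorem hasApproxLift_Icc {ε δ η : ℝ}
    (h : ∀ b : B, IsNullInclusion (p ⁻¹' ball b η) (p ⁻¹' ball b (δ / 2))) (hη : 2 * ε ≤ η)
    (hδ : 2 * ε ≤ δ) {α : ℝ → B}
    (hα : ∀ u ∈ Icc (0 : ℝ) 1, ∀ v ∈ Icc (0 : ℝ) 1, dist (α u) (α v) < ε) :
    HasApproxLift p ε δ (Icc 0 1) {0, 1} α := by
  intro f _ hd
  have h0 : (0 : ℝ) ∈ Icc (0 : ℝ) 1 := by simp
  have h1 : (1 : ℝ) ∈ Icc (0 : ℝ) 1 := by simp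
  have hmem : ∀ u ∈ ({0, 1} : Set ℝ), u ∈ Icc (0 : ℝ) 1 → f u ∈ p ⁻¹' ball (α 0) η := by
    intro u hu hu'
    have := dist_triangle (p (f u)) (α u) (α 0)
    have := hd u hu
    have := hα u hu' 0 h0
    rw [mem_preimage, mem_ball]
    linarith
  have hj := (h (α 0)).1 _ (hmem 0 (by simp) h0) _ (hmem 1 (by simp) h1)
  refine ⟨hj.somePath.extend, hj.somePath.continuous_extend.continuousOn, ?_, ?_⟩
  · rintro u (rfl | rfl) <;> simp
  · intro u hu
    rw [Path.extend_apply _ hu]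
    have h2 : dist (p (hj.somePath ⟨u, hu⟩)) (α 0) < δ / 2 := hj.somePath_mem _
    have := dist_triangle (p (hj.somePath ⟨u, hu⟩)) (α 0) (α u)
    have := hα 0 h0 u hu
    linarith

theorem hasApproxLift_closedBall {ε δ η : ℝ}
    (h : ∀ b : B, IsNullInclusion (p ⁻¹' ball b η) (p ⁻¹' ball b (δ / 2))) (hη : 2 * ε ≤ η)
    (hδ : 2 * ε ≤ δ) {α : ℂ → B}
    (hα : ∀ u ∈ closedBall (0 : ℂ) 1, ∀ v ∈ closedBall (0 : ℂ) 1, dist (α u) (α v) < ε) :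
    HasApproxLift p ε δ (closedBall 0 1) (sphere 0 1) α := by
  intro f hf hd
  have h0 : (0 : ℂ) ∈ closedBall (0 : ℂ) 1 := by simp
  obtain ⟨g, hg, hgU, hgf⟩ := (h (α 0)).2 f hf (by
    intro u hu
    have := dist_triangle (p (f u)) (α u) (α 0)
    have := hd u hu
    have := hα u (sphere_subset_closedBall hu) 0 h0
    rw [mem_preimage, mem_ball]
    linarith)
  refine ⟨g, hg, hgf, fun u hu => ?_⟩
  have h2 : dist (p (g u)) (α 0) < δ / 2 := hgU hu
  have := dist_triangle (p (g u)) (α 0) (α u)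
  have := hα 0 h0 u hu
  linarith

end FibrewiseNull

theorem Complex.exists_square_parametrization (a b : ℝ) :
    ∃ h : ℂ → ℝ × ℝ, Continuous h ∧ Function.Injective h ∧
      h '' closedBall 0 1 = Icc a (a + 1) ×ˢ Icc b (b + 1) ∧
      h '' sphere 0 1 = {z ∈ Icc a (a + 1) ×ˢ Icc b (b + 1) |
        z.1 = a ∨ z.1 = a + 1 ∨ z.2 = b ∨ z.2 = b + 1} := by
  let s : Set (ℝ × ℝ) := Icc a (a + 1) ×ˢ Icc b (b + 1)
  let L : ℂ ≃L[ℝ] ℝ × ℝ := Complex.equivRealProdCLM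
  have hs : IsClosed s := isClosed_Icc.prod isClosed_Icc
  have hfr : frontier s = {z ∈ Icc a (a + 1) ×ˢ Icc b (b + 1) |
      z.1 = a ∨ z.1 = a + 1 ∨ z.2 = b ∨ z.2 = b + 1} := by
    rw [frontier_prod_eq, frontier_Icc (by linarith), frontier_Icc (by linarith), closure_Icc,
      closure_Icc]
    ext ⟨x, y⟩
    simp only [mem_union, mem_prod, mem_Icc, mem_insert_iff, mem_singleton_iff, mem_ofPred_eq]
    constructor
    · rintro (⟨h, rfl | rfl⟩ | ⟨rfl | rfl, h⟩) <;> simp [h]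
    · tauto
  have hinterior : (interior (L ⁻¹' s)).Nonempty := by
    refine ⟨L.symm (a + 1 / 2, b + 1 / 2), ?_⟩
    have := L.toHomeomorph.preimage_interior s
    change _ ∈ interior (L.toHomeomorph ⁻¹' s)
    rw [← this, interior_prod_eq, interior_Icc, interior_Icc]
    change L (L.symm _) ∈ Ioo a (a + 1) ×ˢ Ioo b (b + 1)
    rw [L.apply_symm_apply]
    constructor <;> constructor <;> norm_num
  have hbdd : Bornology.IsBounded (L ⁻¹' s) := by
    have h1 : IsCompact s := isCompact_Icc.prod isCompact_Icc
    exact (L.toHomeomorph.isCompact_preimage.2 h1).isBounded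
  have hconv : Convex ℝ (L ⁻¹' s) :=
    ((convex_Icc a (a + 1)).prod (convex_Icc b (b + 1))).linear_preimage
      (L : ℂ →ₗ[ℝ] ℝ × ℝ)
  obtain ⟨e, -, he, hef⟩ :=
    exists_homeomorph_image_interior_closure_frontier_eq_unitBall hconv hinterior hbdd
  have hcl : closure (L ⁻¹' s) = L ⁻¹' s := (hs.preimage L.continuous).closure_eq
  have hfr' : frontier (L ⁻¹' s) = L ⁻¹' frontier s :=
    (L.toHomeomorph.preimage_frontier s).symm
  refine ⟨fun z => L (e.symm z), by fun_prop, L.injective.comp e.symm.injective, ?_, ?_⟩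
  · rw [← he, hcl, image_image]
    simp only [Homeomorph.symm_apply_apply]
    exact image_preimage_eq _ L.surjective
  · rw [← hef, hfr', image_image, ← hfr]
    simp only [Homeomorph.symm_apply_apply]
    exact image_preimage_eq _ L.surjective

theorem exists_hasApproxLift_unit_cells {X B : Type*} [TopologicalSpace X] [MetricSpace B]
    {p : X → B}
    (h : ∀ ε > 0, ∃ η > 0, ∀ b : B, IsNullInclusion (p ⁻¹' ball b η) (p ⁻¹' ball b ε))
    {δ : ℝ} (hδ : 0 < δ) : ∃ ε > 0, ε ≤ δ ∧
      (∀ α : ℝ → B, (∀ u ∈ Icc (0 : ℝ) 1, ∀ v ∈ Icc (0 : ℝ) 1, dist (α u) (α v) < ε) →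
        HasApproxLift p ε δ (Icc 0 1) {0, 1} α) ∧
      ∀ α : ℂ → B,
        (∀ u ∈ closedBall (0 : ℂ) 1, ∀ v ∈ closedBall (0 : ℂ) 1, dist (α u) (α v) < ε) →
        HasApproxLift p ε δ (closedBall 0 1) (sphere 0 1) α := by
  obtain ⟨η, hη, hnull⟩ := h (δ / 2) (half_pos hδ)
  have h1 : 2 * (min η δ / 2) ≤ η := by linarith [min_le_left η δ]
  have h2 : 2 * (min η δ / 2) ≤ δ := by linarith [min_le_right η δ]
  exact ⟨min η δ / 2, half_pos (lt_min hη hδ), by linarith,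
    fun α hα => hasApproxLift_Icc hnull h1 h2 hα,
    fun α hα => hasApproxLift_closedBall hnull h1 h2 hα⟩

theorem Nat.eq_or_eq_add_one_of_mem_Icc {i k : ℕ} {x : ℝ} (hx : x ∈ Icc (i : ℝ) (i + 1))
    (hk : x = k) : x = i ∨ x = i + 1 := by
  subst hk
  obtain ⟨h1, h2⟩ := hx
  have h1' : i ≤ k := by exact_mod_cast h1
  have h2' : k ≤ i + 1 := by exact_mod_cast h2
  have : k = i ∨ k = i + 1 := by omega
  exact_mod_cast this

theorem Nat.exists_eq_of_mem_Icc_of_mem_Icc {i j : ℕ} (hij : i ≠ j) {x : ℝ}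
    (hi : x ∈ Icc (i : ℝ) (i + 1)) (hj : x ∈ Icc (j : ℝ) (j + 1)) : ∃ k : ℕ, x = k := by
  rcases lt_or_gt_of_ne hij with h | h
  · have h' : (i : ℝ) + 1 ≤ j := by exact_mod_cast h
    exact ⟨j, le_antisymm (hi.2.trans h') hj.1⟩
  · have h' : (j : ℝ) + 1 ≤ i := by exact_mod_cast h
    exact ⟨i, le_antisymm (hj.2.trans h') hi.1⟩

theorem Nat.exists_fin_mem_Icc {N : ℕ} (hN : 0 < N) {x : ℝ} (hx : x ∈ Icc (0 : ℝ) N) :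
    ∃ i : Fin N, x ∈ Icc ((i : ℕ) : ℝ) ((i : ℕ) + 1) := by
  rcases hx.2.eq_or_lt with rfl | h
  · refine ⟨⟨N - 1, by omega⟩, ?_⟩
    have : ((N - 1 : ℕ) : ℝ) = N - 1 := by rw [Nat.cast_sub (by omega)]; simp
    simp [this]
  · exact ⟨⟨⌊x⌋₊, (Nat.floor_lt hx.1).2 h⟩, Nat.floor_le hx.1, (Nat.lt_floor_add_one x).le⟩

section Grid

variable {X B : Type*} [TopologicalSpace X] [MetricSpace B] {p : X → B}

theorem HasApproxLift.of_cells {E ι : Type*} [TopologicalSpace E] [Finite ι] {ε δ : ℝ}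
    {S S' : Set E} (hS : IsClosed S) {C : ι → Set E} (hC : ∀ i, IsClosed (C i))
    (hdisj : ∀ i j, i ≠ j → C i ∩ C j ⊆ S) {α : E → B} (hε : ε ≤ δ)
    (hS' : ∀ u ∈ S', u ∈ S ∨ ∃ i, u ∈ C i)
    (h : ∀ i, C i ⊆ S ∨ HasApproxLift p ε δ (C i) (C i ∩ S) α) :
    HasApproxLift p ε δ S' S α := by
  refine (HasApproxLift.union_iUnion hS hC hdisj hε fun i => ?_).mono_set
    fun u hu => (hS' u hu).imp_right mem_iUnion.2
  rcases h i with h | h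
  · rw [inter_eq_left.2 h]
    exact HasApproxLift.refl hε _ _
  · exact h

/-- Approximate lifting over a subdivided interval, relative to its end points. -/
theorem exists_hasApproxLift_Icc_nat [Nonempty X] (hp : Function.Surjective p)
    (h : ∀ ε > 0, ∃ η > 0, ∀ b : B, IsNullInclusion (p ⁻¹' ball b η) (p ⁻¹' ball b ε))
    {δ : ℝ} (hδ : 0 < δ) : ∃ ε > 0, ε ≤ δ ∧ ∀ N : ℕ, 0 < N → ∀ α : ℝ → B,
      (∀ u ∈ Icc (0 : ℝ) N, ∀ v ∈ Icc (0 : ℝ) N, |u - v| ≤ 1 → dist (α u) (α v) < ε) →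
        HasApproxLift p ε δ (Icc (0 : ℝ) N) {0, (N : ℝ)} α := by
  obtain ⟨ε, hε, hεδ, hcell, -⟩ := exists_hasApproxLift_unit_cells h hδ
  refine ⟨ε, hε, hεδ, fun N hN α hα => ?_⟩
  let S : Set ℝ := {x ∈ Icc (0 : ℝ) N | ∃ k : ℕ, x = k}
  have hSc : IsClosed S := by
    have : S = Icc (0 : ℝ) N ∩ range ((↑) : ℕ → ℝ) := by
      ext x
      simp [S, eq_comm]
    rw [this]
    exact isClosed_Icc.inter Nat.isClosedEmbedding_coe_real.isClosed_range
  have hstart : HasApproxLift p ε ε S {0, (N : ℝ)} α := by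
    refine HasApproxLift.of_cells (ι := Fin (N + 1)) (C := fun i => ({((i : ℕ) : ℝ)} : Set ℝ))
      (toFinite ({0, (N : ℝ)} : Set ℝ)).isClosed (fun _ => isClosed_singleton) ?_ le_rfl ?_ ?_
    · rintro i j hij x ⟨hi, hj⟩
      rw [mem_singleton_iff] at hi hj
      rw [hi] at hj
      exact (hij (Fin.ext (by exact_mod_cast hj))).elim
    · rintro u ⟨hu, k, rfl⟩
      have : k ≤ N := by exact_mod_cast hu.2
      exact Or.inr ⟨⟨k, by omega⟩, rfl⟩
    · intro i
      by_cases hi : ((i : ℕ) : ℝ) ∈ ({0, (N : ℝ)} : Set ℝ)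
      · exact Or.inl (singleton_subset_iff.2 hi)
      · right
        rw [singleton_inter_eq_empty.2 hi]
        exact HasApproxLift.singleton hp hε _ _
  refine hstart.trans ?_ ?_
  · refine HasApproxLift.of_cells (ι := Fin N) (C := fun i => Icc ((i : ℕ) : ℝ) ((i : ℕ) + 1))
      hSc (fun _ => isClosed_Icc) ?_ hεδ ?_ ?_
    · rintro i j hij x ⟨hi, hj⟩
      have hiN : (((i : ℕ) + 1 : ℕ) : ℝ) ≤ N := Nat.cast_le.2 i.2
      push_cast at hiN
      exact ⟨⟨(Nat.cast_nonneg _).trans hi.1, hi.2.trans hiN⟩,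
        Nat.exists_eq_of_mem_Icc_of_mem_Icc (fun h => hij (Fin.ext h)) hi hj⟩
    · exact fun u hu => Or.inr (Nat.exists_fin_mem_Icc hN hu)
    · intro i
      right
      have hiN : (((i : ℕ) + 1 : ℕ) : ℝ) ≤ N := Nat.cast_le.2 i.2
      have hi0 : (0 : ℝ) ≤ (i : ℕ) := Nat.cast_nonneg _
      push_cast at hiN
      have himg : (fun x : ℝ => ((i : ℕ) : ℝ) + x) '' Icc 0 1 =
          Icc ((i : ℕ) : ℝ) ((i : ℕ) + 1) := by
        rw [image_const_add_Icc, add_zero]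
      rw [← himg]
      refine HasApproxLift.image (D' := {0, 1}) isCompact_Icc (by fun_prop)
        (by rintro u (rfl | rfl) <;> simp) ?_ (fun z _ w _ hzw => Or.inl (add_left_cancel hzw))
        (hcell _ ?_)
      · rw [himg, image_pair, add_zero]
        apply Subset.antisymm
        · rintro u (rfl | rfl)
          · exact ⟨⟨le_rfl, by linarith⟩, ⟨hi0, by linarith⟩, i, rfl⟩
          · exact ⟨⟨by linarith, le_rfl⟩, ⟨by linarith, hiN⟩, (i : ℕ) + 1, by push_cast; rfl⟩
        · rintro u ⟨hu, -, k, hk⟩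
          exact Nat.eq_or_eq_add_one_of_mem_Icc hu hk
      · intro u hu v hv
        refine hα _ ⟨by linarith [hu.1], by linarith [hu.2]⟩ _
          ⟨by linarith [hv.1], by linarith [hv.2]⟩ ?_
        rw [abs_le]
        constructor <;> linarith [hu.1, hu.2, hv.1, hv.2]
  · rintro u (rfl | rfl)
    · exact ⟨⟨le_rfl, Nat.cast_nonneg _⟩, 0, by simp⟩
    · exact ⟨⟨Nat.cast_nonneg _, le_rfl⟩, N, rfl⟩

/-- Approximate lifting over a subdivided square, relative to its boundary. -/
theorem exists_hasApproxLift_square_nat [Nonempty X] (hp : Function.Surjective p)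
    (h : ∀ ε > 0, ∃ η > 0, ∀ b : B, IsNullInclusion (p ⁻¹' ball b η) (p ⁻¹' ball b ε))
    {δ : ℝ} (hδ : 0 < δ) : ∃ ε > 0, ε ≤ δ ∧ ∀ N : ℕ, 0 < N → ∀ α : ℝ × ℝ → B,
      (∀ u ∈ Icc (0 : ℝ) N ×ˢ Icc (0 : ℝ) N, ∀ v ∈ Icc (0 : ℝ) N ×ˢ Icc (0 : ℝ) N,
        |u.1 - v.1| ≤ 1 → |u.2 - v.2| ≤ 1 → dist (α u) (α v) < ε) →
      HasApproxLift p ε δ (Icc (0 : ℝ) N ×ˢ Icc (0 : ℝ) N)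
        {z ∈ Icc (0 : ℝ) N ×ˢ Icc (0 : ℝ) N | z.1 = 0 ∨ z.1 = N ∨ z.2 = 0 ∨ z.2 = N} α := by
  obtain ⟨ε₂, hε₂, hε₂δ, -, hdisc⟩ := exists_hasApproxLift_unit_cells h hδ
  obtain ⟨ε₁, hε₁, hε₁₂, hedge, -⟩ := exists_hasApproxLift_unit_cells h hε₂
  obtain ⟨ε₀, hε₀, hε₀₁, hline⟩ := exists_hasApproxLift_Icc_nat hp h hε₁
  refine ⟨ε₀, hε₀, hε₀₁.trans (hε₁₂.trans hε₂δ), fun N hN α hα => ?_⟩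
  have hN0 : (0 : ℝ) ≤ N := Nat.cast_nonneg _
  let Q : Set (ℝ × ℝ) := Icc (0 : ℝ) N ×ˢ Icc (0 : ℝ) N
  have hQ : IsClosed Q := isClosed_Icc.prod isClosed_Icc
  have hclosed : IsClosed (range ((↑) : ℕ → ℝ)) := Nat.isClosedEmbedding_coe_real.isClosed_range
  let S₀ : Set (ℝ × ℝ) := {z ∈ Q | z.1 = 0 ∨ z.1 = N ∨ z.2 = 0 ∨ z.2 = N}
  let S₁ : Set (ℝ × ℝ) := {z ∈ Q | z.1 = 0 ∨ z.1 = N ∨ ∃ k : ℕ, k = z.2}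
  let S₂ : Set (ℝ × ℝ) := {z ∈ Q | (∃ k : ℕ, k = z.1) ∨ ∃ k : ℕ, k = z.2}
  have hS₀ : IsClosed S₀ := by
    refine hQ.inter (.union ?_ (.union ?_ (.union ?_ ?_))) <;>
      exact isClosed_eq (by fun_prop) (by fun_prop)
  have hS₁ : IsClosed S₁ :=
    hQ.inter (.union (isClosed_eq (by fun_prop) (by fun_prop))
      (.union (isClosed_eq (by fun_prop) (by fun_prop)) (hclosed.preimage continuous_snd)))
  have hS₂ : IsClosed S₂ :=
    hQ.inter ((hclosed.preimage continuous_fst).union (hclosed.preimage continuous_snd))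
  have h₀₁ : S₀ ⊆ S₁ := by
    rintro z ⟨hz, h | h | h | h⟩
    · exact ⟨hz, Or.inl h⟩
    · exact ⟨hz, Or.inr (Or.inl h)⟩
    · exact ⟨hz, Or.inr (Or.inr ⟨0, by simp [h]⟩)⟩
    · exact ⟨hz, Or.inr (Or.inr ⟨N, h.symm⟩)⟩
  have h₁₂ : S₁ ⊆ S₂ := by
    rintro z ⟨hz, h | h | h⟩
    · exact ⟨hz, Or.inl ⟨0, by simp [h]⟩⟩
    · exact ⟨hz, Or.inl ⟨N, h.symm⟩⟩
    · exact ⟨hz, Or.inr h⟩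
  have hlines : HasApproxLift p ε₀ ε₁ S₁ S₀ α := by
    refine HasApproxLift.of_cells (ι := Fin (N + 1))
      (C := fun j => Icc (0 : ℝ) N ×ˢ ({((j : ℕ) : ℝ)} : Set ℝ)) hS₀
      (fun _ => isClosed_Icc.prod isClosed_singleton) ?_ hε₀₁ ?_ ?_
    · rintro i j hij x ⟨⟨-, hi⟩, -, hj⟩
      rw [mem_singleton_iff] at hi hj
      rw [hi] at hj
      exact (hij (Fin.ext (by exact_mod_cast hj))).elim
    · rintro ⟨x, y⟩ ⟨hz, h | h | ⟨k, rfl⟩⟩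
      · exact Or.inl ⟨hz, Or.inl h⟩
      · exact Or.inl ⟨hz, Or.inr (Or.inl h)⟩
      · have : k ≤ N := Nat.cast_le.1 hz.2.2
        exact Or.inr ⟨⟨k, by omega⟩, hz.1, rfl⟩
    · intro j
      have hj : ((j : ℕ) : ℝ) ∈ Icc (0 : ℝ) N :=
        ⟨Nat.cast_nonneg _, Nat.cast_le.2 (Nat.lt_succ_iff.1 j.2)⟩
      by_cases hjb : ((j : ℕ) : ℝ) = 0 ∨ ((j : ℕ) : ℝ) = N
      · left
        rintro ⟨x, y⟩ ⟨hx, rfl⟩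
        exact ⟨⟨hx, hj⟩, Or.inr (Or.inr hjb)⟩
      · right
        have himg : (fun x : ℝ => (x, ((j : ℕ) : ℝ))) '' Icc 0 N =
            Icc (0 : ℝ) N ×ˢ ({((j : ℕ) : ℝ)} : Set ℝ) := by
          rw [prod_singleton]
        rw [← himg]
        refine HasApproxLift.image (D' := {0, (N : ℝ)}) isCompact_Icc (by fun_prop)
          (by rintro u (rfl | rfl) <;> simp) ?_
          (fun z _ w _ hzw => Or.inl (congrArg Prod.fst hzw)) (hline N hN _ ?_)
        · rw [himg, image_pair]
          apply Subset.antisymm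
          · rintro u (rfl | rfl)
            · exact ⟨⟨⟨le_rfl, hN0⟩, rfl⟩, ⟨⟨le_rfl, hN0⟩, hj⟩, Or.inl rfl⟩
            · exact ⟨⟨⟨hN0, le_rfl⟩, rfl⟩, ⟨⟨hN0, le_rfl⟩, hj⟩, Or.inr (Or.inl rfl)⟩
          · rintro ⟨x, y⟩ ⟨⟨-, rfl⟩, -, h | h | h⟩
            · exact Or.inl (Prod.ext h rfl)
            · exact Or.inr (Prod.ext h rfl)
            · exact (hjb h).elim
        · intro u hu v hv huv
          exact hα _ ⟨hu, hj⟩ _ ⟨hv, hj⟩ huv (by simp)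
  have hedges : HasApproxLift p ε₁ ε₂ S₂ S₁ α := by
    refine HasApproxLift.of_cells (ι := Fin (N + 1) × Fin N)
      (C := fun i => ({((i.1 : ℕ) : ℝ)} : Set ℝ) ×ˢ Icc ((i.2 : ℕ) : ℝ) ((i.2 : ℕ) + 1)) hS₁
      (fun _ => isClosed_singleton.prod isClosed_Icc) ?_ hε₁₂ ?_ ?_
    · rintro ⟨i, j⟩ ⟨i', j'⟩ hij ⟨x, y⟩ ⟨⟨hi, hj⟩, hi', hj'⟩
      replace hi : x = (i : ℕ) := hi
      replace hi' : x = (i' : ℕ) := hi'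
      have hii : i = i' := Fin.ext (by rw [hi] at hi'; exact_mod_cast hi')
      have hjj : j ≠ j' := fun h => hij (by rw [hii, h])
      obtain ⟨k, hk⟩ := Nat.exists_eq_of_mem_Icc_of_mem_Icc (fun h => hjj (Fin.ext h)) hj hj'
      have hjN : (((j : ℕ) + 1 : ℕ) : ℝ) ≤ N := Nat.cast_le.2 j.2
      push_cast at hjN
      refine ⟨⟨?_, (Nat.cast_nonneg _).trans hj.1, hj.2.trans hjN⟩, Or.inr (Or.inr ⟨k, hk.symm⟩)⟩
      change x ∈ Icc (0 : ℝ) N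
      rw [hi]
      exact ⟨Nat.cast_nonneg _, Nat.cast_le.2 (Nat.lt_succ_iff.1 i.2)⟩
    · rintro ⟨x, y⟩ ⟨hz, ⟨k, rfl⟩ | h⟩
      · have : k ≤ N := Nat.cast_le.1 hz.1.2
        obtain ⟨j, hj⟩ := Nat.exists_fin_mem_Icc hN hz.2
        exact Or.inr ⟨(⟨k, by omega⟩, j), rfl, hj⟩
      · exact Or.inl ⟨hz, Or.inr (Or.inr h)⟩
    · rintro ⟨i, j⟩
      have hi : ((i : ℕ) : ℝ) ∈ Icc (0 : ℝ) N :=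
        ⟨Nat.cast_nonneg _, Nat.cast_le.2 (Nat.lt_succ_iff.1 i.2)⟩
      have hjN : (((j : ℕ) + 1 : ℕ) : ℝ) ≤ N := Nat.cast_le.2 j.2
      push_cast at hjN
      have hj0 : (0 : ℝ) ≤ (j : ℕ) := Nat.cast_nonneg _
      by_cases hib : ((i : ℕ) : ℝ) = 0 ∨ ((i : ℕ) : ℝ) = N
      · left
        rintro ⟨x, y⟩ ⟨rfl, hy⟩
        exact ⟨⟨hi, hj0.trans hy.1, hy.2.trans hjN⟩, hib.imp_right Or.inl⟩
      · right
        have himg : (fun x : ℝ => (((i : ℕ) : ℝ), ((j : ℕ) : ℝ) + x)) '' Icc 0 1 =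
            ({((i : ℕ) : ℝ)} : Set ℝ) ×ˢ Icc ((j : ℕ) : ℝ) ((j : ℕ) + 1) := by
          rw [singleton_prod, ← image_image (fun y : ℝ => (((i : ℕ) : ℝ), y))
            (fun x : ℝ => ((j : ℕ) : ℝ) + x), image_const_add_Icc, add_zero]
        rw [← himg]
        refine HasApproxLift.image (D' := {0, 1}) isCompact_Icc (by fun_prop)
          (by rintro u (rfl | rfl) <;> simp) ?_
          (fun z _ w _ hzw => Or.inl (add_left_cancel (congrArg Prod.snd hzw))) (hedge _ ?_)
        · rw [himg, image_pair, add_zero]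
          apply Subset.antisymm
          · rintro u (rfl | rfl)
            · exact ⟨⟨rfl, le_rfl, by linarith⟩, ⟨hi, hj0, by linarith⟩, Or.inr (Or.inr ⟨j, rfl⟩)⟩
            · exact ⟨⟨rfl, by simp, le_rfl⟩, ⟨hi, by linarith, hjN⟩,
                Or.inr (Or.inr ⟨j + 1, by push_cast; rfl⟩)⟩
          · rintro ⟨x, y⟩ ⟨⟨rfl, hy⟩, -, h | h | ⟨k, hk⟩⟩
            · exact (hib (Or.inl h)).elim
            · exact (hib (Or.inr h)).elim
            · exact (Nat.eq_or_eq_add_one_of_mem_Icc hy hk.symm).imp (fun h => Prod.ext rfl h)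
                fun h => Prod.ext rfl h
        · intro u hu v hv
          refine (hα _ ⟨hi, by linarith [hu.1], by linarith [hu.2]⟩ _
            ⟨hi, by linarith [hv.1], by linarith [hv.2]⟩ (by simp) ?_).trans_le hε₀₁
          rw [abs_le]
          constructor <;> linarith [hu.1, hu.2, hv.1, hv.2]
  refine (hlines.trans hedges h₀₁).trans ?_ (h₀₁.trans h₁₂)
  refine HasApproxLift.of_cells (ι := Fin N × Fin N)
    (C := fun i => Icc ((i.1 : ℕ) : ℝ) ((i.1 : ℕ) + 1) ×ˢ Icc ((i.2 : ℕ) : ℝ) ((i.2 : ℕ) + 1)) hS₂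
    (fun _ => isClosed_Icc.prod isClosed_Icc) ?_ hε₂δ ?_ ?_
  · rintro ⟨i, j⟩ ⟨i', j'⟩ hij ⟨x, y⟩ ⟨⟨hi, hj⟩, hi', hj'⟩
    have hiN : (((i : ℕ) + 1 : ℕ) : ℝ) ≤ N := Nat.cast_le.2 i.2
    have hjN : (((j : ℕ) + 1 : ℕ) : ℝ) ≤ N := Nat.cast_le.2 j.2
    push_cast at hiN hjN
    refine ⟨⟨⟨(Nat.cast_nonneg _).trans hi.1, hi.2.trans hiN⟩,
      (Nat.cast_nonneg _).trans hj.1, hj.2.trans hjN⟩, ?_⟩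
    by_cases hii : i = i'
    · have hjj : j ≠ j' := fun h => hij (by rw [hii, h])
      obtain ⟨k, hk⟩ := Nat.exists_eq_of_mem_Icc_of_mem_Icc (fun h => hjj (Fin.ext h)) hj hj'
      exact Or.inr ⟨k, hk.symm⟩
    · obtain ⟨k, hk⟩ := Nat.exists_eq_of_mem_Icc_of_mem_Icc (fun h => hii (Fin.ext h)) hi hi'
      exact Or.inl ⟨k, hk.symm⟩
  · rintro u ⟨hu₁, hu₂⟩
    obtain ⟨i, hi⟩ := Nat.exists_fin_mem_Icc hN hu₁
    obtain ⟨j, hj⟩ := Nat.exists_fin_mem_Icc hN hu₂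
    exact Or.inr ⟨(i, j), hi, hj⟩
  · rintro ⟨i, j⟩
    right
    have hiN : (((i : ℕ) + 1 : ℕ) : ℝ) ≤ N := Nat.cast_le.2 i.2
    have hjN : (((j : ℕ) + 1 : ℕ) : ℝ) ≤ N := Nat.cast_le.2 j.2
    push_cast at hiN hjN
    have hi0 : (0 : ℝ) ≤ (i : ℕ) := Nat.cast_nonneg _
    have hj0 : (0 : ℝ) ≤ (j : ℕ) := Nat.cast_nonneg _
    have hsub : Icc ((i : ℕ) : ℝ) ((i : ℕ) + 1) ×ˢ Icc ((j : ℕ) : ℝ) ((j : ℕ) + 1) ⊆ Q :=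
      prod_mono (Icc_subset_Icc hi0 hiN) (Icc_subset_Icc hj0 hjN)
    obtain ⟨q, hq, hqi, himg, hfr⟩ := Complex.exists_square_parametrization (i : ℕ) (j : ℕ)
    rw [← himg]
    refine HasApproxLift.image (D' := sphere 0 1) (isCompact_closedBall 0 1) hq.continuousOn
      sphere_subset_closedBall ?_ (fun z _ w _ hzw => Or.inl (hqi hzw)) (hdisc _ ?_)
    · rw [himg, hfr]
      apply Subset.antisymm
      · rintro z ⟨hz, h⟩
        refine ⟨hz, hsub hz, ?_⟩
        rcases h with h | h | h | h
        · exact Or.inl ⟨i, h.symm⟩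
        · exact Or.inl ⟨i + 1, by rw [h]; push_cast; rfl⟩
        · exact Or.inr ⟨j, h.symm⟩
        · exact Or.inr ⟨j + 1, by rw [h]; push_cast; rfl⟩
      · rintro z ⟨hz, -, ⟨k, hk⟩ | ⟨k, hk⟩⟩
        · refine ⟨hz, ?_⟩
          rcases Nat.eq_or_eq_add_one_of_mem_Icc hz.1 hk.symm with h | h
          · exact Or.inl h
          · exact Or.inr (Or.inl h)
        · exact ⟨hz, Or.inr (Or.inr (Nat.eq_or_eq_add_one_of_mem_Icc hz.2 hk.symm))⟩
    · intro u hu v hv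
      have hu' : q u ∈ Icc ((i : ℕ) : ℝ) ((i : ℕ) + 1) ×ˢ Icc ((j : ℕ) : ℝ) ((j : ℕ) + 1) :=
        himg ▸ mem_image_of_mem q hu
      have hv' : q v ∈ Icc ((i : ℕ) : ℝ) ((i : ℕ) + 1) ×ˢ Icc ((j : ℕ) : ℝ) ((j : ℕ) + 1) :=
        himg ▸ mem_image_of_mem q hv
      obtain ⟨⟨hu1, hu2⟩, hu3, hu4⟩ := id hu'
      obtain ⟨⟨hv1, hv2⟩, hv3, hv4⟩ := id hv'
      refine (hα _ (hsub hu') _ (hsub hv') ?_ ?_).trans_le (hε₀₁.trans hε₁₂) <;> rw [abs_le] <;>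
        constructor <;> linarith

end Grid

section UnitCube

variable {X B : Type*} [TopologicalSpace X] [MetricSpace B] {p : X → B}

theorem exists_hasApproxLift_unit_interval [Nonempty X] (hp : Function.Surjective p)
    (h : ∀ ε > 0, ∃ η > 0, ∀ b : B, IsNullInclusion (p ⁻¹' ball b η) (p ⁻¹' ball b ε))
    {δ : ℝ} (hδ : 0 < δ) : ∃ ε > 0, ε ≤ δ ∧ ∀ α : ℝ → B, ContinuousOn α (Icc 0 1) →
      HasApproxLift p ε δ (Icc (0 : ℝ) 1) {0, 1} α := by
  obtain ⟨ε, hε, hεδ, hN⟩ := exists_hasApproxLift_Icc_nat hp h hδ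
  refine ⟨ε, hε, hεδ, fun α hα => ?_⟩
  obtain ⟨η, hη, hunif⟩ := Metric.uniformContinuousOn_iff.1
    (isCompact_Icc.uniformContinuousOn_of_continuous hα) ε hε
  obtain ⟨n, hn⟩ := exists_nat_one_div_lt hη
  have hpos : (0 : ℝ) < (n + 1 : ℕ) := by positivity
  have hn' : 1 / ((n + 1 : ℕ) : ℝ) < η := by push_cast; exact hn
  generalize n + 1 = N at hpos hn'
  have hsc : ∀ x ∈ Icc (0 : ℝ) N, x / N ∈ Icc (0 : ℝ) 1 := fun x hx =>
    ⟨div_nonneg hx.1 hpos.le, (div_le_one hpos).2 hx.2⟩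
  have himg : (fun x : ℝ => x / N) '' Icc 0 (N : ℝ) = Icc 0 1 := by
    apply Subset.antisymm
    · rintro _ ⟨x, hx, rfl⟩
      exact hsc x hx
    · intro x hx
      refine ⟨x * N, ⟨mul_nonneg hx.1 hpos.le, mul_le_of_le_one_left hpos.le hx.2⟩, ?_⟩
      exact mul_div_cancel_right₀ _ hpos.ne'
  rw [← himg]
  refine HasApproxLift.image (D' := {0, (N : ℝ)}) isCompact_Icc (by fun_prop) ?_ ?_ ?_
    (hN N (Nat.cast_pos.1 hpos) _ ?_)
  · rintro x (rfl | rfl)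
    · exact ⟨le_rfl, hpos.le⟩
    · exact ⟨hpos.le, le_rfl⟩
  · rw [image_pair, zero_div, div_self hpos.ne']
  · exact fun z _ w _ hzw => Or.inl ((div_left_inj' hpos.ne').1 hzw)
  · intro u hu v hv huv
    refine hunif _ (hsc u hu) _ (hsc v hv) (lt_of_le_of_lt ?_ hn')
    rw [Real.dist_eq, ← sub_div, abs_div, abs_of_pos hpos]
    gcongr

theorem exists_hasApproxLift_unit_square [Nonempty X] (hp : Function.Surjective p)
    (h : ∀ ε > 0, ∃ η > 0, ∀ b : B, IsNullInclusion (p ⁻¹' ball b η) (p ⁻¹' ball b ε))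
    {δ : ℝ} (hδ : 0 < δ) : ∃ ε > 0, ε ≤ δ ∧ ∀ α : ℝ × ℝ → B,
      ContinuousOn α (Icc 0 1 ×ˢ Icc 0 1) →
      HasApproxLift p ε δ (Icc (0 : ℝ) 1 ×ˢ Icc (0 : ℝ) 1)
        {z ∈ Icc (0 : ℝ) 1 ×ˢ Icc (0 : ℝ) 1 | z.1 = 0 ∨ z.1 = 1 ∨ z.2 = 0 ∨ z.2 = 1} α := by
  obtain ⟨ε, hε, hεδ, hN⟩ := exists_hasApproxLift_square_nat hp h hδ
  refine ⟨ε, hε, hεδ, fun α hα => ?_⟩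
  obtain ⟨η, hη, hunif⟩ := Metric.uniformContinuousOn_iff.1
    ((isCompact_Icc.prod isCompact_Icc).uniformContinuousOn_of_continuous hα) ε hε
  obtain ⟨n, hn⟩ := exists_nat_one_div_lt hη
  have hpos : (0 : ℝ) < (n + 1 : ℕ) := by positivity
  have hn' : 1 / ((n + 1 : ℕ) : ℝ) < η := by push_cast; exact hn
  generalize n + 1 = N at hpos hn'
  have hsc : ∀ x ∈ Icc (0 : ℝ) N, x / N ∈ Icc (0 : ℝ) 1 := fun x hx =>
    ⟨div_nonneg hx.1 hpos.le, (div_le_one hpos).2 hx.2⟩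
  have hsc' : ∀ x ∈ Icc (0 : ℝ) 1, x * N ∈ Icc (0 : ℝ) N := fun x hx =>
    ⟨mul_nonneg hx.1 hpos.le, mul_le_of_le_one_left hpos.le hx.2⟩
  have hcancel : ∀ x : ℝ, x * N / N = x := fun x => mul_div_cancel_right₀ _ hpos.ne'
  have himg : (fun z : ℝ × ℝ => (z.1 / N, z.2 / N)) '' (Icc 0 (N : ℝ) ×ˢ Icc 0 (N : ℝ)) =
      Icc 0 1 ×ˢ Icc 0 1 := by
    apply Subset.antisymm
    · rintro _ ⟨z, hz, rfl⟩
      exact ⟨hsc _ hz.1, hsc _ hz.2⟩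
    · rintro z hz
      exact ⟨(z.1 * N, z.2 * N), ⟨hsc' _ hz.1, hsc' _ hz.2⟩, by simp [hcancel]⟩
  rw [← himg]
  refine HasApproxLift.image
    (D' := {z ∈ Icc (0 : ℝ) N ×ˢ Icc (0 : ℝ) N | z.1 = 0 ∨ z.1 = N ∨ z.2 = 0 ∨ z.2 = N})
    (isCompact_Icc.prod isCompact_Icc) (by fun_prop) (fun z hz => hz.1) ?_ ?_
    (hN N (Nat.cast_pos.1 hpos) _ ?_)
  · rw [himg]
    apply Subset.antisymm
    · rintro _ ⟨z, ⟨hz, hz'⟩, rfl⟩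
      refine ⟨⟨hsc _ hz.1, hsc _ hz.2⟩, ?_⟩
      simp only [div_eq_zero_iff, div_eq_one_iff_eq hpos.ne', hpos.ne', or_false]
      exact hz'
    · rintro z ⟨hz, hz'⟩
      refine ⟨(z.1 * N, z.2 * N), ⟨⟨hsc' _ hz.1, hsc' _ hz.2⟩, ?_⟩, by simp [hcancel]⟩
      rcases hz' with h | h | h | h <;> simp [h]
  · intro z _ w _ hzw
    rw [Prod.mk.injEq, div_left_inj' hpos.ne', div_left_inj' hpos.ne'] at hzw
    exact Or.inl (Prod.ext hzw.1 hzw.2)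
  · intro u hu v hv huv huv'
    refine hunif _ ⟨hsc _ hu.1, hsc _ hu.2⟩ _ ⟨hsc _ hv.1, hsc _ hv.2⟩ (lt_of_le_of_lt ?_ hn')
    rw [Prod.dist_eq, Real.dist_eq, Real.dist_eq, ← sub_div, ← sub_div, abs_div, abs_div,
      abs_of_pos hpos]
    refine max_le ?_ ?_ <;> gcongr

end UnitCube

section Simplex

variable {E : Type*} [NormedAddCommGroup E] [NormedSpace ℝ E]

/-- The union of the proper faces of the simplex with vertex set `s`. -/
def simplexBoundary (s : Finset E) : Set E :=
  ⋃ t ∈ {t : Finset E | t ⊂ s}, convexHull ℝ (t : Set E)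

theorem mem_simplexBoundary {s : Finset E} {u : E} :
    u ∈ simplexBoundary s ↔ ∃ t ⊂ s, u ∈ convexHull ℝ (t : Set E) := by
  simp [simplexBoundary]

theorem AffineIndependent.smul_vsub_eq {a b c : E} (h : AffineIndependent ℝ ![a, b, c])
    {x y x' y' : ℝ} (hxy : x • (b - a) + y • (c - a) = x' • (b - a) + y' • (c - a)) :
    x = x' ∧ y = y' := by
  have hb : AffineIndependent ℝ ![a, b, c] ↔ _ :=
    affineIndependent_iff_linearIndependent_vsub ℝ _ (0 : Fin 3)
  have hli := hb.1 h
  have hli' : LinearIndependent ℝ ![b - a, c - a] := by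
    let e : Fin 2 → {x : Fin 3 // x ≠ 0} := ![⟨1, by decide⟩, ⟨2, by decide⟩]
    have he : Function.Injective e := by
      intro i j
      fin_cases i <;> fin_cases j <;> simp [e]
    have hcomp : ![b - a, c - a] =
        (fun i : {x : Fin 3 // x ≠ 0} => (![a, b, c] i -ᵥ ![a, b, c] 0 : E)) ∘ e := by
      funext i
      fin_cases i <;> rfl
    rw [hcomp]
    exact hli.comp e he
  have h0 : (x - x') • (b - a) + (y - y') • (c - a) = 0 := by
    rw [sub_smul, sub_smul, ← sub_eq_zero.2 hxy]
    abel
  obtain ⟨h1, h2⟩ := LinearIndependent.pair_iff.1 hli' _ _ h0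
  exact ⟨sub_eq_zero.1 h1, sub_eq_zero.1 h2⟩

variable {X B : Type*} [TopologicalSpace X] [MetricSpace B] {p : X → B}

theorem HasApproxLift.segment [Nonempty X] {ε δ : ℝ} {a b : E} (hab : a ≠ b) {α : E → B}
    (h : HasApproxLift p ε δ (Icc (0 : ℝ) 1) {0, 1} (α ∘ AffineMap.lineMap a b)) :
    HasApproxLift p ε δ (segment ℝ a b) {a, b} α := by
  rw [segment_eq_image_lineMap]
  refine h.image isCompact_Icc (by fun_prop) (by rintro u (rfl | rfl) <;> simp) ?_
    fun z _ w _ hzw => Or.inl (AffineMap.lineMap_injective ℝ hab hzw)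
  rw [image_pair, AffineMap.lineMap_apply_zero, AffineMap.lineMap_apply_one]

theorem HasApproxLift.triangle [DecidableEq E] [Nonempty X] {ε δ : ℝ} {a b c : E}
    (habc : AffineIndependent ℝ ![a, b, c])
    {α : E → B}
    (h : HasApproxLift p ε δ (Icc (0 : ℝ) 1 ×ˢ Icc (0 : ℝ) 1)
      {z ∈ Icc (0 : ℝ) 1 ×ˢ Icc (0 : ℝ) 1 | z.1 = 0 ∨ z.1 = 1 ∨ z.2 = 0 ∨ z.2 = 1}
      (α ∘ fun z => AffineMap.lineMap a (AffineMap.lineMap b c z.1) z.2)) :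
    HasApproxLift p ε δ (convexHull ℝ {a, b, c}) (simplexBoundary {a, b, c}) α := by
  have hinj := habc.injective
  have hab : a ≠ b := fun h => by simpa using hinj (a₁ := 0) (a₂ := 1) (by simpa using h)
  have hac : a ≠ c := fun h => by simpa using hinj (a₁ := 0) (a₂ := 2) (by simpa using h)
  have hbc : b ≠ c := fun h => by simpa using hinj (a₁ := 1) (a₂ := 2) (by simpa using h)
  let q : ℝ × ℝ → E := fun z => AffineMap.lineMap a (AffineMap.lineMap b c z.1) z.2
  have hq : ∀ z, q z = a + ((z.2 * (1 - z.1)) • (b - a) + (z.2 * z.1) • (c - a)) := by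
    intro z
    simp only [q, AffineMap.lineMap_apply_module]
    module
  have hqc : Continuous q := by
    rw [funext hq]
    fun_prop
  have himg : q '' (Icc (0 : ℝ) 1 ×ˢ Icc (0 : ℝ) 1) = convexHull ℝ {a, b, c} := by
    rw [convexHull_insert (by simp), convexHull_pair]
    ext u
    simp only [segment_eq_image_lineMap, convexJoin_singleton_left, mem_iUnion, mem_image,
      Prod.exists, mem_prod, exists_prop, q]
    constructor
    · rintro ⟨s, t, ⟨hs, ht⟩, rfl⟩
      exact ⟨_, ⟨s, hs, rfl⟩, t, ht, rfl⟩
    · rintro ⟨_, ⟨s, hs, rfl⟩, t, ht, rfl⟩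
      exact ⟨s, t, ⟨hs, ht⟩, rfl⟩
  have h0 : (0 : ℝ) ∈ Icc (0 : ℝ) 1 := by simp
  have h1 : (1 : ℝ) ∈ Icc (0 : ℝ) 1 := by simp
  rw [← himg]
  refine h.image (isCompact_Icc.prod isCompact_Icc) hqc.continuousOn (fun z hz => hz.1) ?_ ?_
  · apply Subset.antisymm
    · rintro _ ⟨⟨s, t⟩, ⟨⟨hs, ht⟩, hst⟩, rfl⟩
      rw [mem_simplexBoundary]
      rcases hst with rfl | rfl | rfl | rfl
      · refine ⟨{a, b}, ?_, ?_⟩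
        · rw [Finset.ssubset_iff]
          exact ⟨c, by simp [hac.symm, hbc.symm], by grind⟩
        · rw [Finset.coe_pair, convexHull_pair, segment_eq_image_lineMap]
          exact ⟨t, ht, by simp [q]⟩
      · refine ⟨{a, c}, ?_, ?_⟩
        · rw [Finset.ssubset_iff]
          exact ⟨b, by simp [hab.symm, hbc], by grind⟩
        · rw [Finset.coe_pair, convexHull_pair, segment_eq_image_lineMap]
          exact ⟨t, ht, by simp [q]⟩
      · refine ⟨{a}, ?_, by simp [q]⟩
        rw [Finset.ssubset_iff]
        exact ⟨b, by simp [hab.symm], by grind⟩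
      · refine ⟨{b, c}, ?_, ?_⟩
        · rw [Finset.ssubset_iff]
          exact ⟨a, by simp [hab, hac], by grind⟩
        · rw [Finset.coe_pair, convexHull_pair, segment_eq_image_lineMap]
          exact ⟨s, hs, by simp [q]⟩
    · intro u hu
      obtain ⟨t, hts, hu⟩ := mem_simplexBoundary.1 hu
      have hcases : t ⊆ {a, b} ∨ t ⊆ {a, c} ∨ t ⊆ {b, c} := by
        obtain ⟨x, hx, hxt⟩ := Finset.exists_of_ssubset hts
        have hsub := hts.subset
        grind
      have hseg : ∀ x y : E, t ⊆ {x, y} →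
          ∃ r ∈ Icc (0 : ℝ) 1, AffineMap.lineMap x y r = u := by
        intro x y hxy
        have := convexHull_mono (𝕜 := ℝ) (Finset.coe_subset.2 hxy) hu
        rwa [Finset.coe_pair, convexHull_pair, segment_eq_image_lineMap] at this
      rcases hcases with h | h | h
      · obtain ⟨r, hr, rfl⟩ := hseg _ _ h
        exact ⟨(0, r), ⟨⟨h0, hr⟩, Or.inl rfl⟩, by simp [q]⟩
      · obtain ⟨r, hr, rfl⟩ := hseg _ _ h
        exact ⟨(1, r), ⟨⟨h1, hr⟩, Or.inr (Or.inl rfl)⟩, by simp [q]⟩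
      · obtain ⟨r, hr, rfl⟩ := hseg _ _ h
        exact ⟨(r, 1), ⟨⟨hr, h1⟩, Or.inr (Or.inr (Or.inr rfl))⟩, by simp [q]⟩
  · rintro ⟨s, t⟩ hz ⟨s', t'⟩ hw hzw
    change q _ = q _ at hzw
    rw [hq, hq] at hzw
    obtain ⟨h1, h2⟩ := habc.smul_vsub_eq (add_left_cancel hzw)
    simp only at h1 h2
    have ht : t = t' := by linarith
    subst ht
    by_cases ht0 : t = 0
    · exact Or.inr ⟨⟨hz, Or.inr (Or.inr (Or.inl ht0))⟩, hw, Or.inr (Or.inr (Or.inl ht0))⟩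
    · exact Or.inl (Prod.ext (mul_left_cancel₀ ht0 h2) rfl)

/-- Approximate lifting over a simplex of dimension at most two, relative to its boundary. -/
theorem exists_hasApproxLift_simplex [Nonempty X] (hp : Function.Surjective p)
    (h : ∀ ε > 0, ∃ η > 0, ∀ b : B, IsNullInclusion (p ⁻¹' ball b η) (p ⁻¹' ball b ε))
    {k : ℕ} (hk : k ≤ 3) {δ : ℝ} (hδ : 0 < δ) : ∃ ε > 0, ε ≤ δ ∧ ∀ s : Finset E, s.card = k →
      AffineIndependent ℝ ((↑) : s → E) → ∀ α : E → B, ContinuousOn α (convexHull ℝ (s : Set E)) →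
        HasApproxLift p ε δ (convexHull ℝ (s : Set E)) (simplexBoundary s) α := by
  classical
  have hk' : k = 0 ∨ k = 1 ∨ k = 2 ∨ k = 3 := by omega
  rcases hk' with rfl | rfl | rfl | rfl
  · refine ⟨δ, hδ, le_rfl, fun s hs _ α _ => ?_⟩
    rw [Finset.card_eq_zero.1 hs]
    simpa [simplexBoundary] using HasApproxLift.refl le_rfl (∅ : Set E) α
  · refine ⟨δ, hδ, le_rfl, fun s hs _ α _ => ?_⟩
    obtain ⟨a, rfl⟩ := Finset.card_eq_one.1 hs
    simpa [simplexBoundary, Finset.ssubset_singleton_iff] using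
      HasApproxLift.singleton (ε := δ) hp hδ a α
  · obtain ⟨ε, hε, hεδ, hI⟩ := exists_hasApproxLift_unit_interval hp h hδ
    refine ⟨ε, hε, hεδ, fun s hs _ α hα => ?_⟩
    obtain ⟨a, b, hab, rfl⟩ := Finset.card_eq_two.1 hs
    have hbd : simplexBoundary {a, b} = {a, b} := by
      ext u
      rw [mem_simplexBoundary]
      constructor
      · rintro ⟨t, ht, hu⟩
        have ht1 : t.card ≤ 1 := by
          have := Finset.card_lt_card ht
          omega
        have hsub : (t : Set E).Subsingleton := by
          intro x hx y hy
          exact Finset.card_le_one.1 ht1 x hx y hy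
        rw [hsub.convex.convexHull_eq] at hu
        simpa using ht.subset hu
      · rintro (rfl | rfl)
        · exact ⟨{u}, by
            rw [Finset.ssubset_iff]
            exact ⟨b, by simp [hab.symm], by grind⟩, by simp⟩
        · exact ⟨{u}, by
            rw [Finset.ssubset_iff]
            exact ⟨a, by simp [hab], by grind⟩, by simp⟩
    rw [Finset.coe_pair, convexHull_pair] at hα ⊢
    rw [hbd]
    refine (hI _ (hα.comp (by fun_prop) ?_)).segment hab
    rw [segment_eq_image_lineMap]
    exact mapsTo_image _ _
  · obtain ⟨ε, hε, hεδ, hI⟩ := exists_hasApproxLift_unit_square hp h hδ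
    refine ⟨ε, hε, hεδ, fun s hs hind α hα => ?_⟩
    obtain ⟨a, b, c, hab, hac, hbc, rfl⟩ := Finset.card_eq_three.1 hs
    have habc : AffineIndependent ℝ ![a, b, c] := by
      let e : Fin 3 ↪ ({a, b, c} : Finset E) :=
        ⟨![⟨a, by simp⟩, ⟨b, by simp⟩, ⟨c, by simp⟩], by
          intro i j
          fin_cases i <;> fin_cases j <;> simp [hab, hac, hbc, hab.symm, hac.symm, hbc.symm]⟩
      have hcomp : ![a, b, c] = ((↑) : ({a, b, c} : Finset E) → E) ∘ e := by
        funext i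
        fin_cases i <;> rfl
      rw [hcomp]
      exact hind.comp_embedding e
    have hcoe : (({a, b, c} : Finset E) : Set E) = {a, b, c} := by simp
    rw [hcoe] at hα ⊢
    refine HasApproxLift.triangle habc (hI _ (hα.comp ?_ ?_))
    · simp only [AffineMap.lineMap_apply_module]
      fun_prop
    · rintro ⟨s, t⟩ ⟨hs, ht⟩
      rw [convexHull_insert (by simp), convexHull_pair, convexJoin_singleton_left]
      simp only [segment_eq_image_lineMap, mem_iUnion, exists_prop]
      exact ⟨_, mem_image_of_mem _ hs, mem_image_of_mem _ ht⟩

end Simplex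

section Complex

open Geometry

variable {E : Type*} [NormedAddCommGroup E] [NormedSpace ℝ E]

theorem isClosed_biUnion_convexHull {F : Set (Finset E)} (hF : F.Finite) :
    IsClosed (⋃ s ∈ F, convexHull ℝ (s : Set E)) :=
  hF.isClosed_biUnion fun s _ => s.finite_toSet.isClosed_convexHull (𝕜 := ℝ)

namespace Geometry.SimplicialComplex

/-- The union of the subcomplex `K₀` with the `k`-vertex skeleton of `K`. -/
def relativeSkeleton (K K₀ : SimplicialComplex ℝ E) (k : ℕ) : Set E :=
  ⋃ s ∈ {s ∈ K.faces | s ∈ K₀.faces ∨ s.card ≤ k}, convexHull ℝ (s : Set E)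

variable {K K₀ : SimplicialComplex ℝ E}

theorem mem_relativeSkeleton {k : ℕ} {u : E} : u ∈ K.relativeSkeleton K₀ k ↔
    ∃ s ∈ K.faces, (s ∈ K₀.faces ∨ s.card ≤ k) ∧ u ∈ convexHull ℝ (s : Set E) := by
  simp only [relativeSkeleton, mem_iUnion, mem_ofPred_eq, exists_prop, and_assoc]

theorem isClosed_relativeSkeleton (hK : K.faces.Finite) (k : ℕ) :
    IsClosed (K.relativeSkeleton K₀ k) :=
  isClosed_biUnion_convexHull (hK.subset (sep_subset _ _))

theorem relativeSkeleton_zero (h : K₀.faces ⊆ K.faces) : K.relativeSkeleton K₀ 0 = K₀.space := by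
  ext u
  rw [mem_relativeSkeleton, mem_space_iff]
  constructor
  · rintro ⟨s, hs, hs' | hs', hu⟩
    · exact ⟨s, hs', hu⟩
    · have := (K.nonempty_of_mem_faces hs).card_pos
      omega
  · rintro ⟨s, hs, hu⟩
    exact ⟨s, h hs, Or.inl hs, hu⟩

theorem relativeSkeleton_eq_space {k : ℕ} (h : ∀ s ∈ K.faces, s.card ≤ k) :
    K.relativeSkeleton K₀ k = K.space := by
  ext u
  rw [mem_relativeSkeleton, mem_space_iff]
  constructor
  · rintro ⟨s, hs, -, hu⟩
    exact ⟨s, hs, hu⟩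
  · rintro ⟨s, hs, hu⟩
    exact ⟨s, hs, Or.inr (h s hs), hu⟩

theorem relativeSkeleton_mono : Monotone (K.relativeSkeleton K₀) := by
  intro k l hkl u hu
  rw [mem_relativeSkeleton] at hu ⊢
  obtain ⟨s, hs, hs', hu⟩ := hu
  exact ⟨s, hs, hs'.imp_right fun h => h.trans hkl, hu⟩

theorem mem_relativeSkeleton_of_subset {k : ℕ} {s t : Finset E} {u : E} (hs : s ∈ K.faces)
    (hts : t ⊆ s) (ht : t.card ≤ k) (hu : u ∈ convexHull ℝ (t : Set E)) :
    u ∈ K.relativeSkeleton K₀ k := by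
  have hne : t.Nonempty := by
    rw [← Finset.coe_nonempty, ← convexHull_nonempty_iff (𝕜 := ℝ)]
    exact ⟨u, hu⟩
  exact mem_relativeSkeleton.2 ⟨t, K.down_closed hs hts hne, Or.inr ht, hu⟩

theorem mem_convexHull_inter [DecidableEq E] {s t : Finset E} {u : E} (hs : s ∈ K.faces)
    (ht : t ∈ K.faces) (hus : u ∈ convexHull ℝ (s : Set E)) (hut : u ∈ convexHull ℝ (t : Set E)) :
    u ∈ convexHull ℝ ((s ∩ t : Finset E) : Set E) := by
  rw [Finset.coe_inter, ← K.convexHull_inter_convexHull hs ht]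
  exact ⟨hus, hut⟩

theorem convexHull_inter_relativeSkeleton {k : ℕ} {s : Finset E}
    (hs : s ∈ K.faces) (hs₀ : s ∉ K₀.faces) (hsk : s.card = k + 1) :
    convexHull ℝ (s : Set E) ∩ K.relativeSkeleton K₀ k = simplexBoundary s := by
  classical
  ext u
  rw [mem_simplexBoundary]
  constructor
  · rintro ⟨hus, hu⟩
    obtain ⟨t, ht, ht', hut⟩ := mem_relativeSkeleton.1 hu
    refine ⟨s ∩ t, ?_, mem_convexHull_inter hs ht hus hut⟩
    refine Finset.inter_subset_left.ssubset_of_ne fun hst => ?_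
    have hst : s ⊆ t := Finset.inter_eq_left.1 hst
    rcases ht' with ht' | ht'
    · exact hs₀ (K₀.down_closed ht' hst (K.nonempty_of_mem_faces hs))
    · have := Finset.card_le_card hst
      omega
  · rintro ⟨t, hts, hu⟩
    have := Finset.card_lt_card hts
    exact ⟨convexHull_mono (Finset.coe_subset.2 hts.subset) hu,
      mem_relativeSkeleton_of_subset hs hts.subset (by omega) hu⟩

end Geometry.SimplicialComplex

variable {X B : Type*} [TopologicalSpace X] [MetricSpace B] {p : X → B}

open Geometry.SimplicialComplex

/-- Extending approximate lifts over the next skeleton. -/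
theorem exists_hasApproxLift_relativeSkeleton_succ [Nonempty X] (hp : Function.Surjective p)
    (h : ∀ ε > 0, ∃ η > 0, ∀ b : B, IsNullInclusion (p ⁻¹' ball b η) (p ⁻¹' ball b ε))
    {k : ℕ} (hk : k + 1 ≤ 3) {δ : ℝ} (hδ : 0 < δ) : ∃ ε > 0, ∀ K K₀ : SimplicialComplex ℝ E,
      K.faces.Finite → K₀.faces ⊆ K.faces → ∀ α : E → B, ContinuousOn α K.space →
        HasApproxLift p ε δ (K.relativeSkeleton K₀ (k + 1)) (K.relativeSkeleton K₀ k) α := by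
  classical
  obtain ⟨ε, hε, hεδ, hsimplex⟩ := exists_hasApproxLift_simplex (E := E) hp h hk hδ
  refine ⟨ε, hε, fun K K₀ hK hK₀ α hα => ?_⟩
  have : Finite {s // s ∈ K.faces ∧ s.card = k + 1} :=
    (hK.subset (sep_subset _ _)).to_subtype
  refine HasApproxLift.of_cells (ι := {s // s ∈ K.faces ∧ s.card = k + 1})
    (C := fun s => convexHull ℝ (s.1 : Set E)) (isClosed_relativeSkeleton hK k)
    (fun s => s.1.finite_toSet.isClosed_convexHull (𝕜 := ℝ)) ?_ hεδ ?_ ?_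
  · rintro ⟨s, hs, hsk⟩ ⟨t, ht, htk⟩ hst u ⟨hus, hut⟩
    refine mem_relativeSkeleton_of_subset hs Finset.inter_subset_left ?_
      (mem_convexHull_inter hs ht hus hut)
    have hss : s ∩ t ⊂ s := by
      refine Finset.inter_subset_left.ssubset_of_ne fun h => hst (Subtype.ext ?_)
      exact Finset.eq_of_subset_of_card_le (Finset.inter_eq_left.1 h) (htk.trans hsk.symm).le
    have := Finset.card_lt_card hss
    omega
  · intro u hu
    obtain ⟨s, hs, hs', hu⟩ := mem_relativeSkeleton.1 hu
    by_cases hsk : s ∈ K₀.faces ∨ s.card ≤ k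
    · exact Or.inl (mem_relativeSkeleton.2 ⟨s, hs, hsk, hu⟩)
    · exact Or.inr ⟨⟨s, hs, by grind⟩, hu⟩
  · rintro ⟨s, hs, hsk⟩
    by_cases hs₀ : s ∈ K₀.faces
    · exact Or.inl fun u hu => mem_relativeSkeleton.2 ⟨s, hs, Or.inl hs₀, hu⟩
    · right
      rw [convexHull_inter_relativeSkeleton hs hs₀ hsk]
      exact hsimplex s hsk (K.indep hs) α (hα.mono (K.convexHull_subset_space hs))

theorem exists_hasApproxLift_space [Nonempty X] (hp : Function.Surjective p)
    (h : ∀ ε > 0, ∃ η > 0, ∀ b : B, IsNullInclusion (p ⁻¹' ball b η) (p ⁻¹' ball b ε))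
    {δ : ℝ} (hδ : 0 < δ) : ∃ ε > 0, ∀ K K₀ : SimplicialComplex ℝ E, K.faces.Finite →
      (∀ s ∈ K.faces, s.card ≤ 3) → K₀.faces ⊆ K.faces → ∀ α : E → B, ContinuousOn α K.space →
        HasApproxLift p ε δ K.space K₀.space α := by
  obtain ⟨ε₂, hε₂, h₂⟩ :=
    exists_hasApproxLift_relativeSkeleton_succ (E := E) (k := 2) hp h le_rfl hδ
  obtain ⟨ε₁, hε₁, h₁⟩ :=
    exists_hasApproxLift_relativeSkeleton_succ (E := E) (k := 1) hp h (by simp) hε₂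
  obtain ⟨ε₀, hε₀, h₀⟩ :=
    exists_hasApproxLift_relativeSkeleton_succ (E := E) (k := 0) hp h (by simp) hε₁
  refine ⟨ε₀, hε₀, fun K K₀ hK hcard hK₀ α hα => ?_⟩
  rw [← relativeSkeleton_eq_space (K₀ := K₀) hcard, ← relativeSkeleton_zero hK₀]
  refine ((h₀ K K₀ hK hK₀ α hα).trans (h₁ K K₀ hK hK₀ α hα) ?_).trans
    (h₂ K K₀ hK hK₀ α hα) ?_
  · exact relativeSkeleton_mono (by simp)
  · exact relativeSkeleton_mono (by simp)

theorem isUV1Map_of_isNullInclusion [Nonempty X] (hp : Function.Surjective p)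
    (h : ∀ ε > 0, ∃ η > 0, ∀ b : B, IsNullInclusion (p ⁻¹' ball b η) (p ⁻¹' ball b ε)) :
    IsUV1Map p := by
  classical
  intro δ hδ n K K₀ hK hcard hK₀ α₀ α hα₀ hα hcompat
  obtain ⟨ε, hε, hlift⟩ :=
    exists_hasApproxLift_space (E := EuclideanSpace ℝ (Fin n)) hp h hδ
  have : Nonempty B := ‹Nonempty X›.map p
  let f : EuclideanSpace ℝ (Fin n) → X :=
    fun u => if hu : u ∈ K₀.space then α₀ ⟨u, hu⟩ else Classical.arbitrary X
  let β : EuclideanSpace ℝ (Fin n) → B :=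
    fun u => if hu : u ∈ K.space then α ⟨u, hu⟩ else Classical.arbitrary B
  have hf : ∀ u : K₀.space, f u = α₀ u := fun u => dif_pos u.2
  have hβ : ∀ u : K.space, β u = α u := fun u => dif_pos u.2
  have hfc : ContinuousOn f K₀.space := by
    rw [continuousOn_iff_continuous_domRestrict]
    exact hα₀.congr fun u => (hf u).symm
  have hβc : ContinuousOn β K.space := by
    rw [continuousOn_iff_continuous_domRestrict]
    exact hα.congr fun u => (hβ u).symm
  have hsub : K₀.space ⊆ K.space := by
    intro u hu
    obtain ⟨s, hs, hu⟩ := SimplicialComplex.mem_space_iff.1 hu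
    exact K.convexHull_subset_space (hK₀ hs) hu
  obtain ⟨g, hg, hgf, hgd⟩ := hlift K K₀ hK hcard hK₀ β hβc f hfc fun u hu => by
    rw [hf ⟨u, hu⟩, hβ ⟨u, hsub hu⟩, hcompat ⟨u, hu⟩ (hsub hu), dist_self]
    exact hε
  refine ⟨fun u => g u, continuousOn_iff_continuous_domRestrict.1 hg, fun u _ => ?_, fun u => ?_⟩
  · exact (hgf u.2).trans (hf u)
  · rw [← hβ u]
    exact hgd u u.2

end Complex

theorem IsNullInclusion.of_simplyConnectedSpace {X : Type*} [TopologicalSpace X] {W : Set X}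
    (hW : IsPathConnected W) [SimplyConnectedSpace W] : IsNullInclusion W W :=
  isNullInclusion_of_path_homotopic Subset.rfl (fun x hx y hy => hW.joinedIn x hx y hy)
    fun _ _ _ _ => SimplyConnectedSpace.paths_homotopic _ _

end

/-- Collapsing a closed `UV¹` subset of a compact metric space to a point is a
`UV¹` map, provided all other points have arbitrarily small path-connected,
simply connected open neighborhoods. -/
theorem uv1_collapse_map {X B : Type*} [MetricSpace X] [CompactSpace X] [MetricSpace B]
    (A : Set X) (hA_closed : IsClosed A) (hA_uv1 : IsUV1Subset A)
    (h_basis : ∀ x ∈ Set.univ \ A, ∀ U : Set X, IsOpen U → x ∈ U →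
      ∃ W : Set X, IsOpen W ∧ x ∈ W ∧ W ⊆ U ∧ IsPathConnected W ∧ SimplyConnectedSpace W)
    (p : X → B) (b₀ : B)
    (hp_cont : Continuous p) (hp_closed : IsClosedMap p)
    (hp_surj : Function.Surjective p)
    (hpA : ∀ a ∈ A, p a = b₀)
    (hp_inj : Set.InjOn p (Set.univ \ A))
    (h_fiber : p ⁻¹' {b₀} = A) :
    IsUV1Map p := by
  have hX : Nonempty X := (hp_surj b₀).nonempty
  have hB : CompactSpace B := hp_surj.compactSpace hp_cont
  refine isUV1Map_of_isNullInclusion hp_surj fun ε hε => exists_uniform_isNullInclusion ?_ hε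
  intro b U hU hbU
  suffices h : ∃ W, IsOpen W ∧ p ⁻¹' {b} ⊆ W ∧ IsNullInclusion W (p ⁻¹' U) by
    obtain ⟨W, hW, hbW, hnull⟩ := h
    obtain ⟨V, hV, hbV, hVW⟩ := hp_closed.exists_isOpen_preimage_subset hW hbW
    exact ⟨V, hV, hbV, hnull.mono hVW subset_rfl⟩
  have hpU : IsOpen (p ⁻¹' U) := hU.preimage hp_cont
  by_cases hb : b = b₀
  · subst hb
    obtain ⟨V, hVU, hV, hAV, hjoin, hloop⟩ :=
      hA_uv1 _ hpU (fun a ha => by rwa [Set.mem_preimage, hpA a ha])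
    exact ⟨V, hV, h_fiber.trans_subset hAV, isNullInclusion_of_path_homotopic hVU hjoin hloop⟩
  · obtain ⟨x, rfl⟩ := hp_surj b
    have hx : x ∈ Set.univ \ A := ⟨trivial, fun h => hb (hpA x h)⟩
    obtain ⟨W, hW, hxW, hWU, hconn, _⟩ := h_basis x hx _ hpU hbU
    refine ⟨W, hW, fun y hy => ?_, (IsNullInclusion.of_simplyConnectedSpace hconn).mono
      subset_rfl hWU⟩
    have hy : p y = p x := hy
    rwa [hp_inj ⟨trivial, fun h => hb (hy ▸ hpA y h)⟩ hx hy]
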